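/- (Decomposability at critical subspaces, functional constant.) If T ⊂ E_0 is a critical subspace for the datum (c,d,B), then D(c,d,B) = D(c,d,B_T) + D(c,d,B_{E_0/T}). -/

import Mathlib

open MeasureTheory LinearMap
open scoped RealInnerProductSpace BigOperators NNReal ENNReal

noncomputable section

namespace FRBL

/-- A positive semidefinite (self-adjoint) operator on a real inner product space. -/
def PosSemidef {G : Type*} [NormedAddCommGroup G] [InnerProductSpace ℝ G]
    (A : G →ₗ[ℝ] G) : Prop :=
  A.IsSymmetric ∧ ∀ x : G, 0 ≤ ⟪A x, x⟫

/-- A positive definite (self-adjoint) operator on a real inner product space. -/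
def PosDef {G : Type*} [NormedAddCommGroup G] [InnerProductSpace ℝ G]
    (A : G →ₗ[ℝ] G) : Prop :=
  A.IsSymmetric ∧ ∀ x : G, x ≠ 0 → 0 < ⟪A x, x⟫

variable {k m : ℕ}
  (E : Fin k → Type*) (F : Fin m → Type*)
  [∀ i, NormedAddCommGroup (E i)] [∀ i, InnerProductSpace ℝ (E i)]
  [∀ i, FiniteDimensional ℝ (E i)]
  [∀ i, MeasurableSpace (E i)] [∀ i, BorelSpace (E i)]
  [∀ j, NormedAddCommGroup (F j)] [∀ j, InnerProductSpace ℝ (F j)]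
  [∀ j, FiniteDimensional ℝ (F j)]
  [∀ j, MeasurableSpace (F j)] [∀ j, BorelSpace (F j)]
  (c : Fin k → ℝ) (d : Fin m → ℝ)
  (B : ∀ i j, E i →ₗ[ℝ] F j)

/-- The pointwise domination hypothesis of the forward-reverse Brascamp-Lieb inequality. -/
def Hyp (f : ∀ i, E i → ℝ≥0) (g : ∀ j, F j → ℝ≥0) : Prop :=
  ∀ x : ∀ i, E i,
    (∏ i, f i (x i) ^ c i) ≤ ∏ j, g j (∑ i, c i • B i j (x i)) ^ d j

/-- `D₀` is an admissible constant for the forward-reverse Brascamp-Lieb inequality. -/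
def IsBound (D₀ : ℝ) : Prop :=
  ∀ (f : ∀ i, E i → ℝ≥0) (g : ∀ j, F j → ℝ≥0),
    (∀ i, Measurable (f i)) → (∀ j, Measurable (g j)) →
    Hyp E F c d B f g →
    (∏ i, (∫⁻ x, (f i x : ℝ≥0∞)) ^ c i) ≤
      ENNReal.ofReal (Real.exp D₀) * ∏ j, (∫⁻ y, (g j y : ℝ≥0∞)) ^ d j

/-- The best constant `D(c,d,B)` in the forward-reverse Brascamp-Lieb inequality. -/
def D : EReal :=
  sInf {x : EReal | ∃ D₀ : ℝ, x = (D₀ : EReal) ∧ IsBound E F c d B D₀}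

/-- The gaussian constraint `Λ_c B* U_d B Λ_c ≤ V_c`, written via quadratic forms. -/
def GaussCon (V : ∀ i, E i →ₗ[ℝ] E i) (U : ∀ j, F j →ₗ[ℝ] F j) : Prop :=
  ∀ x : ∀ i, E i,
    (∑ j, d j * ⟪U j (∑ i, c i • B i j (x i)), ∑ i, c i • B i j (x i)⟫) ≤
      ∑ i, c i * ⟪V i (x i), x i⟫

/-- The objective functional in the definition of the gaussian constant. -/
def gaussObj (V : ∀ i, E i →ₗ[ℝ] E i) (U : ∀ j, F j →ₗ[ℝ] F j) : ℝ :=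
  (∑ j, d j * Real.log (LinearMap.det (U j)) -
    ∑ i, c i * Real.log (LinearMap.det (V i))) / 2

/-- The gaussian best constant `D_g(c,d,B)`. -/
def Dg : EReal :=
  sSup {x : EReal | ∃ (V : ∀ i, E i →ₗ[ℝ] E i) (U : ∀ j, F j →ₗ[ℝ] F j),
    (∀ i, PosDef (V i)) ∧ (∀ j, PosDef (U j)) ∧ GaussCon E F c d B V U ∧
    x = (gaussObj E F c d V U : EReal)}

/-- The datum `(c,d,B)` is gaussian-extremizable: the supremum defining `D_g` is
finite and attained. -/
def GaussExt : Prop :=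
  ∃ (V : ∀ i, E i →ₗ[ℝ] E i) (U : ∀ j, F j →ₗ[ℝ] F j),
    (∀ i, PosDef (V i)) ∧ (∀ j, PosDef (U j)) ∧ GaussCon E F c d B V U ∧
    Dg E F c d B = (gaussObj E F c d V U : EReal)

/-- The canonical linear equivalence between `E₀ = ⊕ᵢ Eᵢ` (as `PiLp 2`) and the pi type. -/
def toPi : PiLp 2 E ≃ₗ[ℝ] ∀ i, E i := WithLp.linearEquiv 2 ℝ (∀ i, E i)

/-- Orthogonal projection `π_{E_i} : E₀ → E_i`. -/
def projL (i : Fin k) : PiLp 2 E →ₗ[ℝ] E i := (LinearMap.proj i).comp (toPi E).toLinearMap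

/-- The embedding `E_i → E₀`. -/
def singleL (i : Fin k) : E i →ₗ[ℝ] PiLp 2 E :=
  (toPi E).symm.toLinearMap.comp (LinearMap.single ℝ E i)

/-- The map `B_j : E₀ → E^j`, `x ↦ ∑ᵢ B_{ij} π_{E_i} x`. -/
def Bop (j : Fin m) : PiLp 2 E →ₗ[ℝ] F j := ∑ i, (B i j).comp (projL E i)

/-- `Λ_c = ⊕ᵢ cᵢ id_{E_i}` as an operator on `E₀`. -/
def Lam : PiLp 2 E →ₗ[ℝ] PiLp 2 E := ∑ i, c i • (singleL E i).comp (projL E i)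

/-- The set `Π(A_1, …, A_k)` of positive semidefinite "couplings". -/
def Coupling (A : ∀ i, E i →ₗ[ℝ] E i) : Set (PiLp 2 E →ₗ[ℝ] PiLp 2 E) :=
  {P | PosSemidef P ∧ ∀ (i : Fin k) (v : E i),
    ⟪P (singleL E i v), singleL E i v⟫ = ⟪A i v, v⟫}

/-- The scaling condition `∑ᵢ cᵢ dim Eᵢ = ∑ⱼ dⱼ dim E^j`. -/
def ScalingCond : Prop :=
  ∑ i, c i * (Module.finrank ℝ (E i) : ℝ) = ∑ j, d j * (Module.finrank ℝ (F j) : ℝ)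

/-- A subspace `T ⊆ E₀` is of product form, i.e. `T = ⊕ᵢ π_{E_i} T`. -/
def ProductForm (T : Submodule ℝ (PiLp 2 E)) : Prop :=
  ∀ x ∈ T, ∀ i, singleL E i (projL E i x) ∈ T

/-- The dimension condition over product-form subspaces. -/
def DimCond : Prop :=
  ∀ T : Submodule ℝ (PiLp 2 E), ProductForm E T →
    (∑ i, c i * (Module.finrank ℝ (T.map (projL E i)) : ℝ)) ≤
      ∑ j, d j * (Module.finrank ℝ (T.map (Bop E F B j)) : ℝ)

/-- A critical subspace. -/
def IsCritical (T : Submodule ℝ (PiLp 2 E)) : Prop :=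
  T ≠ ⊥ ∧ T ≠ ⊤ ∧ ProductForm E T ∧
    ∑ i, c i * (Module.finrank ℝ (T.map (projL E i)) : ℝ) =
      ∑ j, d j * (Module.finrank ℝ (T.map (Bop E F B j)) : ℝ)

/-- The datum is simple if it has no critical subspace. -/
def Simple : Prop := ∀ T : Submodule ℝ (PiLp 2 E), ¬ IsCritical E F c d B T

end FRBL

namespace FRBL

/-- `log det` with value `−∞` on operators with non-positive determinant
(in particular on singular positive-semidefinite operators). -/
def elogdet {G : Type*} [AddCommGroup G] [Module ℝ G] (A : G →ₗ[ℝ] G) : EReal :=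
  if 0 < LinearMap.det A then ((Real.log (LinearMap.det A) : ℝ) : EReal) else ⊥

variable {k m : ℕ}
  (E : Fin k → Type*) (F : Fin m → Type*)
  [∀ i, NormedAddCommGroup (E i)] [∀ i, InnerProductSpace ℝ (E i)]
  [∀ i, FiniteDimensional ℝ (E i)]
  [∀ j, NormedAddCommGroup (F j)] [∀ j, InnerProductSpace ℝ (F j)]
  [∀ j, FiniteDimensional ℝ (F j)]
  (c : Fin k → ℝ) (d : Fin m → ℝ)
  (B : ∀ i j, E i →ₗ[ℝ] F j)

/-- The map `Q_j := B_j Λ_c : E₀ → E^j`. -/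
def BLam (j : Fin m) : PiLp 2 E →ₗ[ℝ] F j := (Bop E F B j).comp (Lam E c)

/-- The optimality condition of Theorem 2 (structure of gaussian extremizers):
each `B_j Λ_c Π Λ_c B_j*` is invertible and
`∑ⱼ dⱼ Λ_c B_j* (B_j Λ_c Π Λ_c B_j*)⁻¹ B_j Λ_c ≤ V_c` in the quadratic-form sense. -/
def ExtCond (V : ∀ i, E i →ₗ[ℝ] E i) (P : PiLp 2 E →ₗ[ℝ] PiLp 2 E) : Prop :=
  (∀ j, IsUnit ((BLam E F c B j) ∘ₗ P ∘ₗ LinearMap.adjoint (BLam E F c B j))) ∧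
  ∀ x : PiLp 2 E,
    (∑ j, d j * ⟪Ring.inverse ((BLam E F c B j) ∘ₗ P ∘ₗ LinearMap.adjoint (BLam E F c B j))
        (BLam E F c B j x), BLam E F c B j x⟫) ≤
      ∑ i, c i * ⟪V i (projL E i x), projL E i x⟫

/-- A geometric datum. -/
def Geometric : Prop :=
  ScalingCond E F c d ∧
  ∃ S ∈ Coupling E (fun i => (LinearMap.id : E i →ₗ[ℝ] E i)),
    (∀ j, (BLam E F c B j) ∘ₗ S ∘ₗ LinearMap.adjoint (BLam E F c B j) = LinearMap.id) ∧
    ∀ x : PiLp 2 E, (∑ j, d j * ⟪BLam E F c B j x, BLam E F c B j x⟫) ≤ ⟪Lam E c x, x⟫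

/-- Equivalence of data: `B'_j = C_j⁻¹ B_j C⁻¹` for invertible `C, C_j`. -/
def EquivData (B' : ∀ i j, E i →ₗ[ℝ] F j) : Prop :=
  ∃ (C : PiLp 2 E ≃ₗ[ℝ] PiLp 2 E) (Cj : ∀ j, F j ≃ₗ[ℝ] F j),
    ∀ j, Bop E F B' j =
      ((Cj j).symm.toLinearMap ∘ₗ Bop E F B j) ∘ₗ C.symm.toLinearMap

/-- `V_c = ⊕ᵢ cᵢ Vᵢ` as an operator on `E₀`. -/
def blockDiag (V : ∀ i, E i →ₗ[ℝ] E i) : PiLp 2 E →ₗ[ℝ] PiLp 2 E :=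
  ∑ i, c i • ((singleL E i) ∘ₗ (V i)) ∘ₗ (projL E i)

/-- `Θ = V_c − ∑ⱼ dⱼ Λ_c B_j* U_j B_j Λ_c`. -/
def Theta (V : ∀ i, E i →ₗ[ℝ] E i) (U : ∀ j, F j →ₗ[ℝ] F j) :
    PiLp 2 E →ₗ[ℝ] PiLp 2 E :=
  blockDiag E c V -
    ∑ j, d j • (LinearMap.adjoint (BLam E F c B j) ∘ₗ (U j)) ∘ₗ (BLam E F c B j)

end FRBL

namespace FRBL

/-- Borel structure on submodules (inherited from the ambient space). -/
instance subBorel {G : Type*} [AddCommGroup G] [Module ℝ G] [TopologicalSpace G]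
    [MeasurableSpace G] [BorelSpace G] (T : Submodule ℝ G) : BorelSpace ↥T :=
  Subtype.borelSpace (T : Set G)

/-- The maximal dimension of a subspace on which the self-adjoint operator `Q` is positive
definite; by Sylvester's law of inertia this is the number of positive eigenvalues of `Q`,
counted with multiplicity. -/
def posIndex {H : Type*} [NormedAddCommGroup H] [InnerProductSpace ℝ H]
    (Q : H →ₗ[ℝ] H) : ℕ :=
  sSup {r : ℕ | ∃ W : Submodule ℝ H,
    (∀ x ∈ W, x ≠ 0 → 0 < ⟪Q x, x⟫) ∧ Module.finrank ℝ W = r}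

/-- The standard gaussian probability measure on a Euclidean space. -/
def stdGaussian (G : Type*) [NormedAddCommGroup G] [InnerProductSpace ℝ G]
    [FiniteDimensional ℝ G] [MeasurableSpace G] [BorelSpace G] :
    Measure G :=
  volume.withDensity fun x =>
    ENNReal.ofReal ((2 * Real.pi) ^ (-(Module.finrank ℝ G : ℝ) / 2) *
      Real.exp (-‖x‖ ^ 2 / 2))

/-- `K_s = (|s|^{1/s} |s'|^{1/s'})^{1/2}`. -/
def Kconst (s s' : ℝ) : ℝ := Real.sqrt (|s| ^ (1 / s) * |s'| ^ (1 / s'))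

variable {k m : ℕ}
  (E : Fin k → Type*) (F : Fin m → Type*)
  [∀ i, NormedAddCommGroup (E i)] [∀ i, InnerProductSpace ℝ (E i)]
  [∀ i, FiniteDimensional ℝ (E i)]
  [∀ j, NormedAddCommGroup (F j)] [∀ j, InnerProductSpace ℝ (F j)]
  [∀ j, FiniteDimensional ℝ (F j)]
  (c : Fin k → ℝ) (d : Fin m → ℝ)
  (B : ∀ i j, E i →ₗ[ℝ] F j)

/-- The objective functional `∑ⱼ dⱼ log det Uⱼ − ∑ᵢ cᵢ log det Vᵢ`. -/
def objective (V : ∀ i, E i →ₗ[ℝ] E i) (U : ∀ j, F j →ₗ[ℝ] F j) : ℝ :=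
  ∑ j, d j * Real.log (LinearMap.det (U j)) - ∑ i, c i * Real.log (LinearMap.det (V i))

/-- Feasibility for the optimization problem defining `D_g`: positive definiteness
together with the constraint `Θ ≥ 0`. -/
def Admissible (V : ∀ i, E i →ₗ[ℝ] E i) (U : ∀ j, F j →ₗ[ℝ] F j) : Prop :=
  (∀ i, PosDef (V i)) ∧ (∀ j, PosDef (U j)) ∧ PosSemidef (Theta E F c d B V U)

/-- Global maximality in the optimization problem defining `D_g`. -/
def IsGlobalMax (V : ∀ i, E i →ₗ[ℝ] E i) (U : ∀ j, F j →ₗ[ℝ] F j) : Prop :=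
  Admissible E F c d B V U ∧
    ∀ V' U', Admissible E F c d B V' U' →
      objective E F c d V' U' ≤ objective E F c d V U

/-- Local maximality in the optimization problem defining `D_g`. -/
def IsLocalMax (V : ∀ i, E i →ₗ[ℝ] E i) (U : ∀ j, F j →ₗ[ℝ] F j) : Prop :=
  Admissible E F c d B V U ∧
    ∃ ε : ℝ, 0 < ε ∧
      ∀ V' U', Admissible E F c d B V' U' →
        (∀ i, ‖LinearMap.toContinuousLinearMap (V' i - V i)‖ < ε) →
        (∀ j, ‖LinearMap.toContinuousLinearMap (U' j - U j)‖ < ε) →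
        objective E F c d V' U' ≤ objective E F c d V U

end FRBL

namespace FRBL

open Filter Topology Set

set_option linter.unusedSectionVars false

section Tame

variable {G : Type*} [NormedAddCommGroup G] [InnerProductSpace ℝ G] [FiniteDimensional ℝ G]
  [MeasurableSpace G] [BorelSpace G]

/-- Bounded measurable functions with bounded support. -/
def Tame (f : G → ℝ≥0) : Prop :=
  Measurable f ∧ ∃ R : ℝ≥0, ∀ x, f x ≤ R ∧ (f x ≠ 0 → ‖x‖ ≤ R)

theorem Tame.lintegral_ne_top {f : G → ℝ≥0} (hf : Tame f) : ∫⁻ x, (f x : ℝ≥0∞) ≠ ∞ := by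
  obtain ⟨-, R, hR⟩ := hf
  have h : ∀ x, (f x : ℝ≥0∞) ≤ (Metric.closedBall (0 : G) R).indicator (fun _ => (R : ℝ≥0∞)) x := by
    intro x
    by_cases hx : f x = 0
    · simp [hx]
    · rw [indicator_of_mem (by simpa using (hR x).2 hx)]
      exact_mod_cast (hR x).1
  refine ((lintegral_mono h).trans_lt ?_).ne
  rw [lintegral_indicator Metric.isClosed_closedBall.measurableSet]
  simpa using ENNReal.mul_lt_top ENNReal.coe_lt_top measure_closedBall_lt_top

theorem Tame.of_le {f g : G → ℝ≥0} (hf : Tame f) (hg : Measurable g) (hgf : ∀ x, g x ≤ f x) :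
    Tame g := by
  obtain ⟨-, R, hR⟩ := hf
  refine ⟨hg, R, fun x => ⟨(hgf x).trans (hR x).1, fun hx => (hR x).2 fun h0 => hx ?_⟩⟩
  exact le_antisymm (h0 ▸ hgf x) zero_le

theorem tame_indicator_of_isCompact {A : Set G} (hA : IsCompact A) :
    Tame (A.indicator fun _ => (1 : ℝ≥0)) := by
  obtain ⟨R, hR⟩ := hA.isBounded.exists_norm_le
  refine ⟨measurable_const.indicator hA.measurableSet, max 1 R.toNNReal, fun x => ⟨?_, fun hx => ?_⟩⟩
  · exact (indicator_le_self' (fun _ _ => zero_le) x).trans (le_max_left _ _)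
  · have hx' : x ∈ A := by
      by_contra h
      exact hx (indicator_of_notMem h _)
    refine (hR x hx').trans ((Real.le_coe_toNNReal R).trans ?_)
    exact_mod_cast le_max_right _ _

theorem lintegral_indicator_one_coe {A : Set G} (hA : MeasurableSet A) :
    ∫⁻ x, ((A.indicator (fun _ => (1 : ℝ≥0)) x : ℝ≥0) : ℝ≥0∞) = volume A := by
  rw [← lintegral_indicator_one hA]
  refine lintegral_congr fun x => ?_
  by_cases hx : x ∈ A <;> simp [hx]

end Tame

section Basic

variable {ι : Type*} [Fintype ι] {c : ι → ℝ}

theorem prod_rpow_eq_zero_iff (hc : ∀ i, 0 < c i) {a : ι → ℝ≥0∞} :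
    ∏ i, a i ^ c i = 0 ↔ ∃ i, a i = 0 := by
  simp [Finset.prod_eq_zero_iff, hc, (hc _).not_gt]

theorem prod_nnrpow_eq_zero_iff (hc : ∀ i, 0 < c i) {a : ι → ℝ≥0} :
    ∏ i, a i ^ c i = 0 ↔ ∃ i, a i = 0 := by
  simp [Finset.prod_eq_zero_iff, NNReal.rpow_eq_zero_iff, (hc _).ne']

theorem prod_rpow_ne_top (hc : ∀ i, 0 < c i) {a : ι → ℝ≥0∞} (ha : ∀ i, a i ≠ ∞) :
    ∏ i, a i ^ c i ≠ ∞ :=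
  ENNReal.prod_ne_top fun i _ => ENNReal.rpow_ne_top_of_nonneg (hc i).le (ha i)

theorem prod_rpow_mono (hc : ∀ i, 0 < c i) {a b : ι → ℝ≥0∞} (hab : ∀ i, a i ≤ b i) :
    ∏ i, a i ^ c i ≤ ∏ i, b i ^ c i :=
  Finset.prod_le_prod' fun i _ => ENNReal.rpow_le_rpow (hab i) (hc i).le

theorem prod_nnrpow_mono (hc : ∀ i, 0 < c i) {a b : ι → ℝ≥0} (hab : ∀ i, a i ≤ b i) :
    ∏ i, a i ^ c i ≤ ∏ i, b i ^ c i :=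
  Finset.prod_le_prod' fun i _ => NNReal.rpow_le_rpow (hab i) (hc i).le

theorem tendsto_prod_rpow {α : Type*} {l : Filter α} (hc : ∀ i, 0 < c i)
    {u : ι → α → ℝ≥0∞} {a : ι → ℝ≥0∞} (ha : ∀ i, a i ≠ ∞) (h : ∀ i, Tendsto (u i) l (𝓝 (a i))) :
    Tendsto (fun t => ∏ i, u i t ^ c i) l (𝓝 (∏ i, a i ^ c i)) :=
  ENNReal.tendsto_finsetProd_of_ne_top _
    (fun i _ => ((ENNReal.continuous_rpow_const).tendsto _).comp (h i))
    fun i _ => ENNReal.rpow_ne_top_of_nonneg (hc i).le (ha i)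

theorem tendsto_prod_rpow_of_ne_zero {α : Type*} {l : Filter α} (hc : ∀ i, 0 < c i)
    {u : ι → α → ℝ≥0∞} {a : ι → ℝ≥0∞} (ha : ∀ i, a i ≠ 0) (h : ∀ i, Tendsto (u i) l (𝓝 (a i))) :
    Tendsto (fun t => ∏ i, u i t ^ c i) l (𝓝 (∏ i, a i ^ c i)) := by
  classical
  have ha' : ∀ i, a i ^ c i ≠ 0 := fun i => by simp [hc, ha, (hc _).not_gt]
  suffices H : ∀ s : Finset ι, Tendsto (fun t => ∏ i ∈ s, u i t ^ c i) l (𝓝 (∏ i ∈ s, a i ^ c i)) from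
    H _
  intro s
  induction s using Finset.induction_on with
  | empty => simpa using tendsto_const_nhds
  | insert i s hi ih =>
    simp only [Finset.prod_insert hi]
    exact ENNReal.Tendsto.mul (((ENNReal.continuous_rpow_const).tendsto _).comp (h i))
      (Or.inl (ha' i)) ih (Or.inl (Finset.prod_ne_zero_iff.2 fun j _ => ha' j))

theorem coe_prod_rpow (hc : ∀ i, 0 < c i) (a : ι → ℝ≥0) :
    ((∏ i, a i ^ c i : ℝ≥0) : ℝ≥0∞) = ∏ i, (a i : ℝ≥0∞) ^ c i := by
  rw [ENNReal.ofNNReal_finsetProd]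
  exact Finset.prod_congr rfl fun i _ => ENNReal.coe_rpow_of_nonneg _ (hc i).le

end Basic

section SumMap

variable {k m : ℕ} {E : Fin k → Type*} {F : Fin m → Type*}
  [∀ i, NormedAddCommGroup (E i)] [∀ i, InnerProductSpace ℝ (E i)]
  [∀ i, FiniteDimensional ℝ (E i)]
  [∀ j, NormedAddCommGroup (F j)] [∀ j, InnerProductSpace ℝ (F j)]
  {c : Fin k → ℝ} {B : ∀ i j, E i →ₗ[ℝ] F j}

/-- The map `x ↦ ∑ᵢ cᵢ B_{ij} xᵢ` as a continuous linear map. -/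
def sumMap (c : Fin k → ℝ) (B : ∀ i j, E i →ₗ[ℝ] F j) (j : Fin m) : (∀ i, E i) →L[ℝ] F j :=
  ∑ i, c i • (LinearMap.toContinuousLinearMap (B i j)).comp (ContinuousLinearMap.proj i)

theorem sumMap_apply (j : Fin m) (x : ∀ i, E i) : sumMap c B j x = ∑ i, c i • B i j (x i) := by
  simp [sumMap]

theorem hyp_iff {d : Fin m → ℝ} {f : ∀ i, E i → ℝ≥0} {g : ∀ j, F j → ℝ≥0} :
    Hyp E F c d B f g ↔
      ∀ x, ∏ i, f i (x i) ^ c i ≤ ∏ j, g j (sumMap c B j x) ^ d j := by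
  simp only [Hyp, sumMap_apply]

end SumMap
section Reduction

variable {ι : Type*} [Fintype ι] {k m : ℕ}
  {E : Fin k → Type*} {F : Fin m → Type*}
  [∀ i, NormedAddCommGroup (E i)] [∀ i, InnerProductSpace ℝ (E i)]
  [∀ i, FiniteDimensional ℝ (E i)]
  [∀ i, MeasurableSpace (E i)] [∀ i, BorelSpace (E i)]
  [∀ j, NormedAddCommGroup (F j)] [∀ j, InnerProductSpace ℝ (F j)]
  [∀ j, FiniteDimensional ℝ (F j)]
  [∀ j, MeasurableSpace (F j)] [∀ j, BorelSpace (F j)]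
  {c : Fin k → ℝ} {d : Fin m → ℝ} {B : ∀ i j, E i →ₗ[ℝ] F j}

/-- The product `∏ᵢ (∫ fᵢ)^{cᵢ}`. -/
def intProd {G : ι → Type*} [∀ i, NormedAddCommGroup (G i)] [∀ i, InnerProductSpace ℝ (G i)]
    [∀ i, FiniteDimensional ℝ (G i)] [∀ i, MeasurableSpace (G i)] [∀ i, BorelSpace (G i)]
    (c : ι → ℝ) (f : ∀ i, G i → ℝ≥0) : ℝ≥0∞ :=
  ∏ i, (∫⁻ x, (f i x : ℝ≥0∞)) ^ c i

theorem hyp_indicator (hc : ∀ i, 0 < c i) {A : ∀ i, Set (E i)} {S : ∀ j, Set (F j)}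
    (h : ∀ x : ∀ i, E i, (∀ i, x i ∈ A i) → ∀ j, sumMap c B j x ∈ S j) :
    Hyp E F c d B (fun i => (A i).indicator fun _ => 1) fun j => (S j).indicator fun _ => 1 := by
  intro x
  by_cases hx : ∀ i, x i ∈ A i
  · have hS := h x hx
    simp only [sumMap_apply] at hS
    simp [hx, hS]
  · push Not at hx
    obtain ⟨i, hi⟩ := hx
    rw [(prod_nnrpow_eq_zero_iff hc).2 ⟨i, by simp [hi]⟩]
    exact zero_le

variable (E F c d B) in
theorem exists_tame_hyp (hc : ∀ i, 0 < c i) :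
    ∃ (f : ∀ i, E i → ℝ≥0) (g : ∀ j, F j → ℝ≥0), (∀ i, Tame (f i)) ∧ (∀ j, Tame (g j)) ∧
      Hyp E F c d B f g ∧ intProd c f ≠ 0 := by
  refine ⟨fun i => (Metric.closedBall 0 1).indicator fun _ => 1,
    fun j => (Metric.closedBall 0 ‖sumMap c B j‖).indicator fun _ => 1,
    fun i => tame_indicator_of_isCompact (isCompact_closedBall _ _),
    fun j => tame_indicator_of_isCompact (isCompact_closedBall _ _),
    hyp_indicator hc fun x hx j => ?_, ?_⟩
  · have hx' : ‖x‖ ≤ 1 := (pi_norm_le_iff_of_nonneg zero_le_one).2 fun i => by simpa using hx i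
    simpa using (sumMap c B j).le_of_opNorm_le_of_le le_rfl hx'
  · simp only [intProd, lintegral_indicator_one_coe Metric.isClosed_closedBall.measurableSet]
    rw [Ne, prod_rpow_eq_zero_iff hc]
    rintro ⟨i, hi⟩
    exact (Metric.measure_closedBall_pos volume (0 : E i) one_pos).ne' hi

theorem intProd_ne_top (hc : ∀ i, 0 < c i) {f : ∀ i, E i → ℝ≥0} (hf : ∀ i, Tame (f i)) :
    intProd c f ≠ ∞ :=
  prod_rpow_ne_top hc fun i => (hf i).lintegral_ne_top

/-- The forward-reverse inequality with constant `C`, restricted to tame functions. -/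
def TameBound (c : Fin k → ℝ) (d : Fin m → ℝ) (B : ∀ i j, E i →ₗ[ℝ] F j) (C : ℝ≥0∞) : Prop :=
  ∀ (f : ∀ i, E i → ℝ≥0) (g : ∀ j, F j → ℝ≥0), (∀ i, Tame (f i)) → (∀ j, Tame (g j)) →
    Hyp E F c d B f g → intProd c f ≤ C * intProd d g

theorem TameBound.intProd_eq_zero (hc : ∀ i, 0 < c i) (hd : ∀ j, 0 < d j) {C : ℝ≥0∞}
    (h : TameBound c d B C) {f : ∀ i, E i → ℝ≥0} {g : ∀ j, F j → ℝ≥0}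
    (hf : ∀ i, Measurable (f i)) (hg : ∀ j, Measurable (g j)) (hfg : Hyp E F c d B f g)
    {j₀ : Fin m} (hj : ∫⁻ y, (g j₀ y : ℝ≥0∞) = 0) : intProd c f = 0 := by
  by_contra hne
  simp only [intProd, prod_rpow_eq_zero_iff hc, not_exists] at hne
  have hA : ∀ i, ∃ A ⊆ {x | f i x ≠ 0}, IsCompact A ∧ 0 < volume A := by
    intro i
    refine MeasurableSet.exists_lt_isCompact (measurableSet_eq_fun (hf i) measurable_const).compl ?_
    rw [pos_iff_ne_zero]
    intro h0
    refine hne i ((lintegral_eq_zero_iff (hf i).coe_nnreal_ennreal).2 ?_)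
    rw [EventuallyEq, ae_iff]
    simpa [compl_ofPred] using h0
  choose A hAf hAc hAv using hA
  have hS : ∀ j, IsCompact (sumMap c B j '' univ.pi A) := fun j =>
    (isCompact_univ_pi hAc).image (sumMap c B j).continuous
  have key := h _ _ (fun i => tame_indicator_of_isCompact (hAc i))
    (fun j => tame_indicator_of_isCompact (hS j))
    (hyp_indicator hc fun x hx j => mem_image_of_mem _ fun i _ => hx i)
  have hS0 : volume (sumMap c B j₀ '' univ.pi A) = 0 := by
    rw [lintegral_eq_zero_iff (hg j₀).coe_nnreal_ennreal, EventuallyEq, ae_iff] at hj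
    refine measure_mono_null ?_ hj
    rintro _ ⟨x, hx, rfl⟩ h0
    have h1 := hfg x
    rw [(prod_nnrpow_eq_zero_iff hd).2 ⟨j₀, by simpa [sumMap_apply] using h0⟩, le_zero_iff,
      prod_nnrpow_eq_zero_iff hc] at h1
    obtain ⟨i, hi⟩ := h1
    exact hAf i (hx i (mem_univ i)) hi
  simp only [intProd, lintegral_indicator_one_coe (hAc _).measurableSet,
    lintegral_indicator_one_coe (hS _).measurableSet] at key
  rw [(prod_rpow_eq_zero_iff hd).2 ⟨j₀, hS0⟩, mul_zero, le_zero_iff, prod_rpow_eq_zero_iff hc] at key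
  obtain ⟨i, hi⟩ := key
  exact (hAv i).ne' hi

/-- A truncation level above which a single large value compensates for all other values being
at least `ε`. -/
theorem exists_truncation_level (hd : ∀ j, 0 < d j) (K ε : ℝ≥0) (hε : 0 < ε) :
    ∃ M : ℝ≥0, ∀ v : Fin m → ℝ≥0, (∀ j, ε ≤ v j) → (∃ j, M ≤ v j) → K ≤ ∏ j, v j ^ d j := by
  have hP : ∀ j, 0 < ∏ l ∈ Finset.univ.erase j, ε ^ d l := fun j =>
    Finset.prod_pos fun l _ => NNReal.rpow_pos hε
  refine ⟨∑ j, (K / ∏ l ∈ Finset.univ.erase j, ε ^ d l) ^ (d j)⁻¹, ?_⟩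
  rintro v hv ⟨j, hj⟩
  have h1 : (K / ∏ l ∈ Finset.univ.erase j, ε ^ d l) ^ (d j)⁻¹ ≤ v j :=
    (Finset.single_le_sum (f := fun j => (K / ∏ l ∈ Finset.univ.erase j, ε ^ d l) ^ (d j)⁻¹)
      (fun _ _ => zero_le) (Finset.mem_univ j)).trans hj
  have h2 : K / ∏ l ∈ Finset.univ.erase j, ε ^ d l ≤ v j ^ d j := by
    rwa [NNReal.rpow_inv_le_iff (hd j)] at h1
  rw [div_le_iff₀ (hP j)] at h2
  rw [← Finset.mul_prod_erase _ _ (Finset.mem_univ j)]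
  refine h2.trans (mul_le_mul_right ?_ _)
  exact Finset.prod_le_prod' fun l _ => NNReal.rpow_le_rpow (hv l) (hd l).le

theorem TameBound.of_tame_left (hc : ∀ i, 0 < c i) (hd : ∀ j, 0 < d j) {C : ℝ≥0∞} (hC : C ≠ ∞)
    (h : TameBound c d B C) {f : ∀ i, E i → ℝ≥0} {g : ∀ j, F j → ℝ≥0}
    (hf : ∀ i, Tame (f i)) (hg : ∀ j, Measurable (g j)) (hfg : Hyp E F c d B f g)
    (hg' : ∀ j, ∫⁻ y, (g j y : ℝ≥0∞) ≠ ∞) : intProd c f ≤ C * intProd d g := by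
  choose R hR using fun i => (hf i).2
  set ρ : ℝ≥0 := ∑ i, R i
  have hρ : ∀ i, R i ≤ ρ := fun i =>
    Finset.single_le_sum (f := R) (fun _ _ => zero_le) (Finset.mem_univ i)
  set V : Fin m → ℝ≥0∞ := fun j => volume (Metric.closedBall (0 : F j) (‖sumMap c B j‖ * ρ))
  have hV : ∀ j, V j ≠ ∞ := fun j => measure_closedBall_lt_top.ne
  have key : ∀ ε : ℝ≥0, 0 < ε →
      intProd c f ≤ C * ∏ j, ((∫⁻ y, (g j y : ℝ≥0∞)) + ε * V j) ^ d j := by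
    intro ε hε
    obtain ⟨M, hM⟩ := exists_truncation_level hd (∏ i, R i ^ c i) ε hε
    set S : ∀ j, Set (F j) := fun j => Metric.closedBall 0 (‖sumMap c B j‖ * ρ)
    have hS : ∀ j, MeasurableSet (S j) := fun j => Metric.isClosed_closedBall.measurableSet
    set u : ∀ j, F j → ℝ≥0 := fun j => (S j).indicator fun y => min (max (g j y) ε) (max M ε)
    have hu : ∀ j, Tame (u j) := by
      intro j
      refine ⟨(((hg j).max measurable_const).min measurable_const).indicator (hS j),
        max (max M ε) (‖sumMap c B j‖₊ * ρ), fun y => ?_⟩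
      by_cases hy : y ∈ S j
      · simp only [u, indicator_of_mem hy]
        refine ⟨(min_le_right _ _).trans (le_max_left _ _), fun _ => ?_⟩
        rw [mem_closedBall_zero_iff] at hy
        exact hy.trans (by push_cast; exact le_max_right _ _)
      · simp [u, hy]
    have hyp : Hyp E F c d B f u := by
      intro x
      by_cases hx : ∃ i, f i (x i) = 0
      · rw [(prod_nnrpow_eq_zero_iff hc).2 hx]
        exact zero_le
      push Not at hx
      have hxρ : ‖x‖ ≤ ρ := (pi_norm_le_iff_of_nonneg ρ.2).2 fun i =>
        ((hR i (x i)).2 (hx i)).trans (hρ i)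
      have hy : ∀ j, sumMap c B j x ∈ S j := fun j => by
        simpa [S] using (sumMap c B j).le_of_opNorm_le_of_le le_rfl hxρ
      have hu' : ∀ j, u j (∑ i, c i • B i j (x i)) =
          min (max (g j (∑ i, c i • B i j (x i))) ε) (max M ε) := fun j => by
        rw [← sumMap_apply]
        exact indicator_of_mem (hy j) _
      simp only [hu']
      by_cases hbig : ∃ j, M ≤ g j (∑ i, c i • B i j (x i))
      · obtain ⟨j, hj⟩ := hbig
        refine le_trans (prod_nnrpow_mono hc fun i => (hR i (x i)).1) (hM _ (fun j => ?_) ⟨j, ?_⟩)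
        · exact le_min (le_max_right _ _) (le_max_right _ _)
        · exact le_min (hj.trans (le_max_left _ _)) (le_max_left _ _)
      · push Not at hbig
        refine (hfg x).trans (prod_nnrpow_mono hd fun j => ?_)
        exact le_min (le_max_left _ _) ((hbig j).le.trans (le_max_left _ _))
    refine (h f u hf hu hyp).trans (mul_le_mul_right (prod_rpow_mono hd fun j => ?_) _)
    calc ∫⁻ y, (u j y : ℝ≥0∞)
        ≤ ∫⁻ y, ((g j y : ℝ≥0∞) + (S j).indicator (fun _ => (ε : ℝ≥0∞)) y) := by
          refine lintegral_mono fun y => ?_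
          by_cases hy : y ∈ S j
          · simp only [u, indicator_of_mem hy]
            have : min (max (g j y) ε) (max M ε) ≤ g j y + ε :=
              (min_le_left _ _).trans (max_le (le_add_of_nonneg_right zero_le)
                (le_add_of_nonneg_left zero_le))
            exact_mod_cast this
          · simp [u, hy]
      _ = _ := by
          rw [lintegral_add_left (hg j).coe_nnreal_ennreal, lintegral_indicator_const (hS j)]
  have hlim : Tendsto (fun ε : ℝ≥0 => C * ∏ j, ((∫⁻ y, (g j y : ℝ≥0∞)) + ε * V j) ^ d j) (𝓝[>] 0)
      (𝓝 (C * intProd d g)) := by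
    refine ENNReal.Tendsto.const_mul (tendsto_prod_rpow hd hg' fun j => ?_) (Or.inr hC)
    refine tendsto_nhdsWithin_of_tendsto_nhds ?_
    have h0 : Tendsto (fun ε : ℝ≥0 => (ε : ℝ≥0∞)) (𝓝 0) (𝓝 0) := by
      simpa using ENNReal.continuous_coe.tendsto (0 : ℝ≥0)
    simpa using (ENNReal.Tendsto.mul_const h0 (Or.inr (hV j))).const_add
      (∫⁻ y, (g j y : ℝ≥0∞))
  exact ge_of_tendsto hlim (eventually_nhdsWithin_of_forall fun ε hε => key ε hε)

/-- It suffices to test the forward-reverse inequality on tame functions. -/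
theorem TameBound.intProd_le (hc : ∀ i, 0 < c i) (hd : ∀ j, 0 < d j) {C : ℝ≥0∞} (hC : C ≠ ∞)
    (hC0 : C ≠ 0) (h : TameBound c d B C) {f : ∀ i, E i → ℝ≥0} {g : ∀ j, F j → ℝ≥0}
    (hf : ∀ i, Measurable (f i)) (hg : ∀ j, Measurable (g j)) (hfg : Hyp E F c d B f g) :
    intProd c f ≤ C * intProd d g := by
  by_cases hz : ∃ j, ∫⁻ y, (g j y : ℝ≥0∞) = 0
  · obtain ⟨j, hj⟩ := hz
    rw [h.intProd_eq_zero hc hd hf hg hfg hj]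
    exact zero_le
  by_cases ht : ∃ j, ∫⁻ y, (g j y : ℝ≥0∞) = ∞
  · obtain ⟨j, hj⟩ := ht
    have : intProd d g = ∞ := by
      rw [intProd, ← Finset.mul_prod_erase _ _ (Finset.mem_univ j), hj,
        ENNReal.top_rpow_of_pos (hd j)]
      refine ENNReal.top_mul (Finset.prod_ne_zero_iff.2 fun l _ => ?_)
      rw [Ne, ENNReal.rpow_eq_zero_iff]
      push Not at hz
      simp [hz l, (hd l).not_gt]
    rw [this, ENNReal.mul_top hC0]
    exact le_top
  by_cases hfz : ∃ i, ∫⁻ x, (f i x : ℝ≥0∞) = 0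
  · rw [intProd, (prod_rpow_eq_zero_iff hc).2 hfz]
    exact zero_le
  push Not at hz ht hfz
  set A : ∀ i, ℕ → Set (E i) := fun i n => Metric.closedBall 0 n ∩ {x | f i x ≤ n}
  set u : ∀ i, ℕ → E i → ℝ≥0 := fun i n => (A i n).indicator (f i)
  have hA : ∀ i n, MeasurableSet (A i n) := fun i n =>
    Metric.isClosed_closedBall.measurableSet.inter (measurableSet_le (hf i) measurable_const)
  have hum : ∀ i n, Measurable (u i n) := fun i n => (hf i).indicator (hA i n)
  have hu : ∀ i n, Tame (u i n) := by
    refine fun i n => ⟨hum i n, n, fun x => ?_⟩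
    by_cases hx : x ∈ A i n
    · simp only [u, indicator_of_mem hx]
      exact ⟨hx.2, fun _ => by simpa using hx.1⟩
    · simp [u, hx]
  have hlim : Tendsto (fun n => intProd c fun i => u i n) atTop (𝓝 (intProd c f)) := by
    refine tendsto_prod_rpow_of_ne_zero hc hfz fun i => ?_
    refine lintegral_tendsto_of_tendsto_of_monotone
      (fun n => (hum i n).coe_nnreal_ennreal.aemeasurable) (ae_of_all _ fun x n n' hn => ?_)
      (ae_of_all _ fun x => ?_)
    · refine ENNReal.coe_le_coe.2 (indicator_le_indicator_of_subset ?_ (fun _ => zero_le) x)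
      refine inter_subset_inter (Metric.closedBall_subset_closedBall (by exact_mod_cast hn))
        fun y hy => ?_
      exact le_trans (show f i y ≤ n from hy) (by exact_mod_cast hn)
    · refine tendsto_const_nhds.congr' ?_
      obtain ⟨n₁, h₁⟩ := exists_nat_ge ‖x‖
      obtain ⟨n₂, h₂⟩ := exists_nat_ge (f i x)
      filter_upwards [eventually_ge_atTop (max n₁ n₂)] with n hn
      refine congrArg _ (indicator_of_mem ?_ _).symm
      refine ⟨?_, h₂.trans (by exact_mod_cast (le_max_right _ _).trans hn)⟩
      simpa using h₁.trans (by exact_mod_cast (le_max_left _ _).trans hn)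
  refine le_of_tendsto' hlim fun n => h.of_tame_left hc hd hC (fun i => hu i n) hg (fun x => ?_) ht
  exact (prod_nnrpow_mono hc fun i => indicator_le_self' (fun _ _ => zero_le) _).trans (hfg x)

end Reduction

section Perturbation

variable {k m : ℕ}
  {E : Fin k → Type*} {F : Fin m → Type*}
  [∀ i, NormedAddCommGroup (E i)] [∀ i, InnerProductSpace ℝ (E i)]
  [∀ i, FiniteDimensional ℝ (E i)]
  [∀ j, NormedAddCommGroup (F j)] [∀ j, InnerProductSpace ℝ (F j)]
  [∀ j, FiniteDimensional ℝ (F j)]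
  {c : Fin k → ℝ} {d : Fin m → ℝ} {B : ∀ i j, E i →ₗ[ℝ] F j}

theorem eventually_prod_le (hc : ∀ i, 0 < c i) (hd : ∀ j, 0 < d j)
    {u : ∀ i, E i → ℝ≥0} {g v : ∀ j, F j → ℝ≥0}
    (hu : ∀ i, UpperSemicontinuous (u i)) (hv : ∀ j, LowerSemicontinuous (v j))
    (hgv : ∀ j y, g j y < v j y) (hug : Hyp E F c d B u g) (x₀ : ∀ i, E i) :
    ∀ᶠ z : (∀ j, F j) × (∀ i, E i) in 𝓝 (0, x₀),
      ∏ i, u i (z.2 i) ^ c i ≤ ∏ j, v j (sumMap c B j z.2 + z.1 j) ^ d j := by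
  rcases isEmpty_or_nonempty (Fin m) with hm | hm
  · refine Eventually.of_forall fun z => ?_
    simpa using hug z.2
  choose q hgq hqv using fun j => exists_between (hgv j (sumMap c B j x₀))
  have hlt : ∏ i, u i (x₀ i) ^ c i < ∏ j, q j ^ d j := by
    have hle : ∏ i, u i (x₀ i) ^ c i ≤ ∏ j, g j (sumMap c B j x₀) ^ d j :=
      hyp_iff.1 hug x₀
    refine hle.trans_lt ?_
    by_cases h0 : ∃ j, g j (sumMap c B j x₀) = 0
    · rw [(prod_nnrpow_eq_zero_iff hd).2 h0]
      exact Finset.prod_pos fun j _ => NNReal.rpow_pos (pos_of_gt (hgq j))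
    · push Not at h0
      exact Finset.prod_lt_prod_of_nonempty (fun j _ => NNReal.rpow_pos (pos_iff_ne_zero.2 (h0 j)))
        (fun j _ => NNReal.rpow_lt_rpow (hgq j) (hd j)) Finset.univ_nonempty
  have hη : ∀ᶠ η : ℝ≥0 in 𝓝[>] 0, ∏ i, (u i (x₀ i) + η) ^ c i < ∏ j, q j ^ d j := by
    have ht : Tendsto (fun η : ℝ≥0 => ∏ i, (u i (x₀ i) + η) ^ c i) (𝓝 0)
        (𝓝 (∏ i, u i (x₀ i) ^ c i)) := by
      refine tendsto_finsetProd _ fun i _ => ?_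
      refine Tendsto.nnrpow ?_ tendsto_const_nhds (Or.inr (hc i))
      simpa using (tendsto_id (α := ℝ≥0) (x := 𝓝 0)).const_add (u i (x₀ i))
    exact (ht.eventually_lt_const hlt).filter_mono nhdsWithin_le_nhds
  obtain ⟨η, hη', hη0⟩ := (hη.and self_mem_nhdsWithin).exists
  have h1 : ∀ i, ∀ᶠ z : (∀ j, F j) × (∀ i, E i) in 𝓝 (0, x₀), u i (z.2 i) < u i (x₀ i) + η := by
    intro i
    have hcont : Tendsto (fun z : (∀ j, F j) × (∀ i, E i) => z.2 i) (𝓝 (0, x₀)) (𝓝 (x₀ i)) :=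
      ((continuous_apply i).comp continuous_snd).tendsto _
    exact hcont.eventually (hu i (x₀ i) _ (lt_add_of_pos_right _ hη0))
  have h2 : ∀ j, ∀ᶠ z : (∀ j, F j) × (∀ i, E i) in 𝓝 (0, x₀),
      q j < v j (sumMap c B j z.2 + z.1 j) := by
    intro j
    have hcont : Tendsto (fun z : (∀ j, F j) × (∀ i, E i) => sumMap c B j z.2 + z.1 j)
        (𝓝 (0, x₀)) (𝓝 (sumMap c B j x₀)) := by
      have : Continuous fun z : (∀ j, F j) × (∀ i, E i) => sumMap c B j z.2 + z.1 j := by fun_prop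
      simpa using this.tendsto (0, x₀)
    exact hcont.eventually (hv j _ _ (hqv j))
  filter_upwards [eventually_all.2 h1, eventually_all.2 h2] with z hz1 hz2
  exact (prod_nnrpow_mono hc fun i => (hz1 i).le).trans
    (hη'.le.trans (prod_nnrpow_mono hd fun j => (hz2 j).le))

/-- A pointwise domination with upper semicontinuous left-hand side of bounded support and lower
semicontinuous right-hand side with some slack is stable under small translations. -/
theorem exists_perturbation (hc : ∀ i, 0 < c i) (hd : ∀ j, 0 < d j)
    {u : ∀ i, E i → ℝ≥0} {g v : ∀ j, F j → ℝ≥0} {ρ : ℝ} (hρ : 0 ≤ ρ)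
    (hu : ∀ i, UpperSemicontinuous (u i)) (hsupp : ∀ i x, u i x ≠ 0 → ‖x‖ ≤ ρ)
    (hv : ∀ j, LowerSemicontinuous (v j))
    (hgv : ∀ j y, g j y < v j y) (hug : Hyp E F c d B u g) :
    ∃ δ : ℝ, 0 < δ ∧ ∀ w : ∀ j, F j, (∀ j, ‖w j‖ < δ) → ∀ x : ∀ i, E i,
      ∏ i, u i (x i) ^ c i ≤ ∏ j, v j (sumMap c B j x + w j) ^ d j := by
  have hK : IsCompact (Metric.closedBall (0 : ∀ i, E i) ρ) := isCompact_closedBall _ _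
  have hev := hK.eventually_forall_of_forall_eventually
    (P := fun (w : ∀ j, F j) x => ∏ i, u i (x i) ^ c i ≤ ∏ j, v j (sumMap c B j x + w j) ^ d j)
    fun x _ => eventually_prod_le hc hd hu hv hgv hug x
  obtain ⟨δ, hδ, hball⟩ := Metric.eventually_nhds_iff.1 hev
  refine ⟨δ, hδ, fun w hw x => ?_⟩
  by_cases hx : ∃ i, u i (x i) = 0
  · rw [(prod_nnrpow_eq_zero_iff hc).2 hx]
    exact zero_le
  push Not at hx
  refine hball ?_ x ?_
  · rw [dist_zero_right]
    exact (pi_norm_lt_iff hδ).2 hw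
  · rw [mem_closedBall_zero_iff]
    exact (pi_norm_le_iff_of_nonneg hρ).2 fun i => hsupp i _ (hx i)

end Perturbation

section Approximation

variable {G : Type*} [NormedAddCommGroup G] [InnerProductSpace ℝ G] [FiniteDimensional ℝ G]
  [MeasurableSpace G] [BorelSpace G]

theorem Tame.exists_lowerSemicontinuous {g : G → ℝ≥0} (hg : Tame g) {ε : ℝ≥0∞} (hε : ε ≠ 0) :
    ∃ v : G → ℝ≥0, (∀ y, g y < v y) ∧ LowerSemicontinuous v ∧
      ∫⁻ y, (v y : ℝ≥0∞) ≤ (∫⁻ y, (g y : ℝ≥0∞)) + ε := by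
  obtain ⟨hgm, R, hR⟩ := hg
  obtain ⟨v, hgv, hv, hint⟩ := exists_lt_lowerSemicontinuous_lintegral_ge volume g hgm hε
  have hcoe : ∀ y, (((min (v y) (R + 1 : ℝ≥0)).toNNReal : ℝ≥0) : ℝ≥0∞) = min (v y) (R + 1 : ℝ≥0) :=
    fun y => ENNReal.coe_toNNReal ((min_le_right _ _).trans_lt ENNReal.coe_lt_top).ne
  refine ⟨fun y => (min (v y) (R + 1 : ℝ≥0)).toNNReal, fun y => ?_, fun y q hq => ?_, ?_⟩
  · rw [← ENNReal.coe_lt_coe, hcoe, lt_min_iff]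
    exact ⟨hgv y, ENNReal.coe_lt_coe.2 ((hR y).1.trans_lt (lt_add_one R))⟩
  · simp only [← ENNReal.coe_lt_coe, hcoe, lt_min_iff] at hq ⊢
    filter_upwards [hv y _ hq.1] with z hz
    exact ⟨hz, hq.2⟩
  · refine le_trans (lintegral_mono fun y => ?_) hint
    rw [hcoe]
    exact min_le_left _ _

theorem lintegral_comp_inv_smul {f : G → ℝ≥0∞} (hf : Measurable f) {t : ℝ} (ht : 0 < t) :
    ∫⁻ x, f (t⁻¹ • x) = ENNReal.ofReal (t ^ Module.finrank ℝ G) * ∫⁻ x, f x := by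
  have h := Measure.map_addHaar_smul (volume : Measure G) (inv_ne_zero ht.ne')
  rw [← lintegral_map hf (measurable_const_smul t⁻¹), h, lintegral_smul_measure, inv_pow, inv_inv,
    abs_of_pos (pow_pos ht _), smul_eq_mul]

theorem prod_ofReal_pow_rpow {ι : Type*} [Fintype ι] (c : ι → ℝ) (n : ι → ℕ) {t : ℝ} (ht : 0 < t) :
    ∏ i, ENNReal.ofReal (t ^ n i) ^ c i = ENNReal.ofReal (t ^ ∑ i, c i * n i) := by
  rw [Real.rpow_sum_of_pos ht, ENNReal.ofReal_prod_of_nonneg fun i _ => (Real.rpow_pos_of_pos ht _).le]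
  refine Finset.prod_congr rfl fun i _ => ?_
  rw [ENNReal.ofReal_rpow_of_pos (pow_pos ht _), ← Real.rpow_natCast, ← Real.rpow_mul ht.le, mul_comm]

end Approximation
section Splitting

variable {k m : ℕ}
  {E ET EQ : Fin k → Type*} {F FT FQ : Fin m → Type*}
  [∀ i, NormedAddCommGroup (E i)] [∀ i, InnerProductSpace ℝ (E i)]
  [∀ i, FiniteDimensional ℝ (E i)]
  [∀ i, MeasurableSpace (E i)] [∀ i, BorelSpace (E i)]
  [∀ i, NormedAddCommGroup (ET i)] [∀ i, InnerProductSpace ℝ (ET i)]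
  [∀ i, FiniteDimensional ℝ (ET i)]
  [∀ i, MeasurableSpace (ET i)] [∀ i, BorelSpace (ET i)]
  [∀ i, NormedAddCommGroup (EQ i)] [∀ i, InnerProductSpace ℝ (EQ i)]
  [∀ i, FiniteDimensional ℝ (EQ i)]
  [∀ i, MeasurableSpace (EQ i)] [∀ i, BorelSpace (EQ i)]
  [∀ j, NormedAddCommGroup (F j)] [∀ j, InnerProductSpace ℝ (F j)]
  [∀ j, FiniteDimensional ℝ (F j)]
  [∀ j, MeasurableSpace (F j)] [∀ j, BorelSpace (F j)]
  [∀ j, NormedAddCommGroup (FT j)] [∀ j, InnerProductSpace ℝ (FT j)]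
  [∀ j, FiniteDimensional ℝ (FT j)]
  [∀ j, MeasurableSpace (FT j)] [∀ j, BorelSpace (FT j)]
  [∀ j, NormedAddCommGroup (FQ j)] [∀ j, InnerProductSpace ℝ (FQ j)]
  [∀ j, FiniteDimensional ℝ (FQ j)]
  [∀ j, MeasurableSpace (FQ j)] [∀ j, BorelSpace (FQ j)]

/-- Measure-preserving splittings `E i ≃ ET i × EQ i`, `F j ≃ FT j × FQ j` in which the maps
`B i j` are block upper triangular, with diagonal blocks `BT i j`, `BQ i j`. -/
structure Splitting (B : ∀ i j, E i →ₗ[ℝ] F j) (BT : ∀ i j, ET i →ₗ[ℝ] FT j)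
    (BQ : ∀ i j, EQ i →ₗ[ℝ] FQ j) where
  eE : ∀ i, (ET i × EQ i) ≃L[ℝ] E i
  eF : ∀ j, (FT j × FQ j) ≃L[ℝ] F j
  mpE : ∀ i, MeasurePreserving (eE i) (volume.prod volume) volume
  mpF : ∀ j, MeasurePreserving (eF j) (volume.prod volume) volume
  R : ∀ i j, EQ i →ₗ[ℝ] FT j
  map_eE : ∀ i j x x', B i j (eE i (x, x')) = eF j (BT i j x + R i j x', BQ i j x')

variable {c : Fin k → ℝ} {d : Fin m → ℝ} {B : ∀ i j, E i →ₗ[ℝ] F j}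
  {BT : ∀ i j, ET i →ₗ[ℝ] FT j} {BQ : ∀ i j, EQ i →ₗ[ℝ] FQ j}

theorem Splitting.sumMap_eE (σ : Splitting B BT BQ) (j : Fin m) (x : ∀ i, ET i)
    (x' : ∀ i, EQ i) :
    sumMap c B j (fun i => σ.eE i (x i, x' i)) =
      σ.eF j (sumMap c BT j x + sumMap c σ.R j x', sumMap c BQ j x') := by
  simp only [sumMap_apply, σ.map_eE, ← map_smul, ← map_sum, ← Finset.sum_add_distrib]
  congr 1
  ext
  · simp [Prod.fst_sum]
  · simp [Prod.snd_sum]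

section Slice

variable {G GT GQ : Type*}
  [NormedAddCommGroup G] [InnerProductSpace ℝ G] [FiniteDimensional ℝ G]
  [MeasurableSpace G] [BorelSpace G]
  [NormedAddCommGroup GT] [InnerProductSpace ℝ GT] [FiniteDimensional ℝ GT]
  [MeasurableSpace GT] [BorelSpace GT]
  [NormedAddCommGroup GQ] [InnerProductSpace ℝ GQ] [FiniteDimensional ℝ GQ]
  [MeasurableSpace GQ] [BorelSpace GQ] (e : (GT × GQ) ≃L[ℝ] G)

/-- The integral of a function along the first factor of a splitting. -/
def fiberInt (f : G → ℝ≥0) (x' : GQ) : ℝ≥0 := (∫⁻ x, (f (e (x, x')) : ℝ≥0∞)).toNNReal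

theorem Tame.slice {f : G → ℝ≥0} (hf : Tame f) (x' : GQ) : Tame fun x => f (e (x, x')) := by
  obtain ⟨hfm, R, hR⟩ := hf
  refine ⟨hfm.comp (by fun_prop), max R (‖(e.symm : G →L[ℝ] GT × GQ)‖₊ * R), fun x => ⟨?_, fun hx => ?_⟩⟩
  · exact (hR _).1.trans (le_max_left _ _)
  · have h1 := (e.symm : G →L[ℝ] GT × GQ).le_of_opNorm_le_of_le le_rfl ((hR _).2 hx)
    have h2 : ‖x‖ ≤ ‖(e.symm : G →L[ℝ] GT × GQ)‖ * R :=
      (norm_fst_le (x, x')).trans (by simpa using h1)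
    exact h2.trans (by push_cast; exact le_max_right _ _)

theorem coe_fiberInt {f : G → ℝ≥0} (hf : Tame f) (x' : GQ) :
    (fiberInt e f x' : ℝ≥0∞) = ∫⁻ x, (f (e (x, x')) : ℝ≥0∞) :=
  ENNReal.coe_toNNReal (hf.slice e x').lintegral_ne_top

theorem measurable_fiberInt {f : G → ℝ≥0} (hf : Measurable f) : Measurable (fiberInt e f) := by
  have h : Measurable fun p : GT × GQ => (f (e p) : ℝ≥0∞) :=
    (hf.comp e.continuous.measurable).coe_nnreal_ennreal
  exact h.lintegral_prod_left'.ennreal_toNNReal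

theorem lintegral_fiberInt {f : G → ℝ≥0} (hf : Tame f)
    (he : MeasurePreserving e (volume.prod volume) volume) :
    ∫⁻ x', (fiberInt e f x' : ℝ≥0∞) = ∫⁻ x, (f x : ℝ≥0∞) := by
  have h : Measurable fun p : GT × GQ => (f (e p) : ℝ≥0∞) :=
    (hf.1.comp e.continuous.measurable).coe_nnreal_ennreal
  rw [← he.lintegral_comp hf.1.coe_nnreal_ennreal, lintegral_prod_symm' _ h]
  exact lintegral_congr fun x' => coe_fiberInt e hf x'

theorem lintegral_splitting_mul (he : MeasurePreserving e (volume.prod volume) volume)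
    {u : GT → ℝ≥0} {v : GQ → ℝ≥0} (hu : Measurable u) (hv : Measurable v) :
    ∫⁻ x, ((u (e.symm x).1 * v (e.symm x).2 : ℝ≥0) : ℝ≥0∞) =
      (∫⁻ x, (u x : ℝ≥0∞)) * ∫⁻ x, (v x : ℝ≥0∞) := by
  have hm : Measurable fun x => ((u (e.symm x).1 * v (e.symm x).2 : ℝ≥0) : ℝ≥0∞) :=
    ((hu.comp (by fun_prop)).mul (hv.comp (by fun_prop))).coe_nnreal_ennreal
  rw [← he.lintegral_comp hm]
  simp only [ContinuousLinearEquiv.symm_apply_apply, ENNReal.coe_mul]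
  exact lintegral_prod_mul hu.coe_nnreal_ennreal.aemeasurable hv.coe_nnreal_ennreal.aemeasurable

end Slice

theorem exists_prod_rpow_eq_exp [Nonempty (Fin k)] (hc : ∀ i, 0 < c i) (a : ℝ) :
    ∃ s : ℝ≥0, ∏ i, (s : ℝ≥0∞) ^ c i = ENNReal.ofReal (Real.exp a) := by
  have h0 : 0 < ∑ i, c i := Finset.sum_pos (fun i _ => hc i) Finset.univ_nonempty
  refine ⟨(Real.exp (a / ∑ i, c i)).toNNReal, ?_⟩
  change ∏ i, ENNReal.ofReal (Real.exp (a / ∑ i, c i)) ^ c i = _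
  simp only [ENNReal.ofReal_rpow_of_pos (Real.exp_pos _), ← Real.exp_mul]
  rw [← ENNReal.ofReal_prod_of_nonneg fun i _ => (Real.exp_pos _).le, ← Real.exp_sum,
    ← Finset.mul_sum, div_mul_cancel₀ _ h0.ne']

theorem ofReal_exp_mul_ofReal_exp_neg_mul (a : ℝ) (x : ℝ≥0∞) :
    ENNReal.ofReal (Real.exp a) * (ENNReal.ofReal (Real.exp (-a)) * x) = x := by
  rw [← mul_assoc, ← ENNReal.ofReal_mul (Real.exp_pos _).le, ← Real.exp_add, add_neg_cancel,
    Real.exp_zero, ENNReal.ofReal_one, one_mul]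

/-- Bounds for the two diagonal blocks add up to a bound for the whole datum. -/
theorem Splitting.isBound_add (σ : Splitting B BT BQ) [Nonempty (Fin k)] (hc : ∀ i, 0 < c i)
    (hd : ∀ j, 0 < d j) {a b : ℝ} (ha : IsBound ET FT c d BT a) (hb : IsBound EQ FQ c d BQ b) :
    IsBound E F c d B (a + b) := by
  refine fun f g hf hg hfg => TameBound.intProd_le hc hd ENNReal.ofReal_ne_top
    (by simpa using Real.exp_pos _) (fun f g hf hg hfg => ?_) hf hg hfg
  obtain ⟨s, hs⟩ := exists_prod_rpow_eq_exp hc (-a)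
  have hmul : ∀ p : Fin k → ℝ≥0∞,
      ∏ i, (s * p i) ^ c i = ENNReal.ofReal (Real.exp (-a)) * ∏ i, p i ^ c i := fun p => by
    simp only [ENNReal.mul_rpow_of_nonneg _ _ (hc _).le, Finset.prod_mul_distrib, hs]
  have hyp : Hyp EQ FQ c d BQ (fun i x' => s * fiberInt (σ.eE i) (f i) x')
      fun j => fiberInt (σ.eF j) (g j) := by
    refine hyp_iff.2 fun x' => ?_
    rw [← ENNReal.coe_le_coe, coe_prod_rpow hc, coe_prod_rpow hd]
    simp only [ENNReal.coe_mul, hmul, coe_fiberInt _ (hf _), coe_fiberInt _ (hg _)]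
    have hslice : Hyp ET FT c d BT (fun i x => f i (σ.eE i (x, x' i)))
        fun j y => g j (σ.eF j (y + sumMap c σ.R j x', sumMap c BQ j x')) := by
      refine hyp_iff.2 fun x => ?_
      simpa only [σ.sumMap_eE] using hyp_iff.1 hfg fun i => σ.eE i (x i, x' i)
    have h1 := ha _ (fun j y => g j (σ.eF j (y + sumMap c σ.R j x', sumMap c BQ j x')))
      (fun i => ((hf i).slice _ _).1)
      (fun j => ((hg j).slice (σ.eF j) (sumMap c BQ j x')).1.comp
        (measurable_id.add_const (sumMap c σ.R j x'))) hslice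
    have h2 : ∀ j, ∫⁻ y, (g j (σ.eF j (y + sumMap c σ.R j x', sumMap c BQ j x')) : ℝ≥0∞) =
        ∫⁻ y, (g j (σ.eF j (y, sumMap c BQ j x')) : ℝ≥0∞) := fun j =>
      lintegral_add_right_eq_self
        (fun y => (g j (σ.eF j (y, sumMap c BQ j x')) : ℝ≥0∞)) (sumMap c σ.R j x')
    simp only [h2] at h1
    refine (mul_le_mul_right h1 _).trans_eq ?_
    simpa using ofReal_exp_mul_ofReal_exp_neg_mul (-a) _
  have h := hb _ _ (fun i => (measurable_fiberInt (σ.eE i) (hf i).1).const_mul s)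
    (fun j => measurable_fiberInt (σ.eF j) (hg j).1) hyp
  simp only [ENNReal.coe_mul, lintegral_const_mul' _ _ ENNReal.coe_ne_top, hmul,
    lintegral_fiberInt _ (hf _) (σ.mpE _), lintegral_fiberInt _ (hg _) (σ.mpF _)] at h
  rw [← ofReal_exp_mul_ofReal_exp_neg_mul a (intProd c f), Real.exp_add,
    ENNReal.ofReal_mul (Real.exp_pos _).le, mul_assoc]
  exact mul_le_mul_right h _

theorem intProd_tensor {ι : Type*} [Fintype ι] {G GT GQ : ι → Type*}
    [∀ i, NormedAddCommGroup (G i)] [∀ i, InnerProductSpace ℝ (G i)]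
    [∀ i, FiniteDimensional ℝ (G i)] [∀ i, MeasurableSpace (G i)] [∀ i, BorelSpace (G i)]
    [∀ i, NormedAddCommGroup (GT i)] [∀ i, InnerProductSpace ℝ (GT i)]
    [∀ i, FiniteDimensional ℝ (GT i)] [∀ i, MeasurableSpace (GT i)] [∀ i, BorelSpace (GT i)]
    [∀ i, NormedAddCommGroup (GQ i)] [∀ i, InnerProductSpace ℝ (GQ i)]
    [∀ i, FiniteDimensional ℝ (GQ i)] [∀ i, MeasurableSpace (GQ i)] [∀ i, BorelSpace (GQ i)]
    (e : ∀ i, (GT i × GQ i) ≃L[ℝ] G i)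
    (he : ∀ i, MeasurePreserving (e i) (volume.prod volume) volume)
    {c : ι → ℝ} (hc : ∀ i, 0 < c i) {u : ∀ i, GT i → ℝ≥0} {v : ∀ i, GQ i → ℝ≥0}
    (hu : ∀ i, Measurable (u i)) (hv : ∀ i, Measurable (v i)) {t : ℝ} (ht : 0 < t) :
    intProd c (fun i x => u i (t⁻¹ • ((e i).symm x).1) * v i ((e i).symm x).2) =
      ENNReal.ofReal (t ^ ∑ i, c i * Module.finrank ℝ (GT i)) * (intProd c u * intProd c v) := by
  simp only [intProd]
  rw [← prod_ofReal_pow_rpow c _ ht, ← Finset.prod_mul_distrib, ← Finset.prod_mul_distrib]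
  refine Finset.prod_congr rfl fun i _ => ?_
  rw [lintegral_splitting_mul (e i) (he i) (u := fun x => u i (t⁻¹ • x))
      ((hu i).comp (measurable_const_smul _)) (hv i),
    lintegral_comp_inv_smul (f := fun x => (u i x : ℝ≥0∞)) (hu i).coe_nnreal_ennreal ht, mul_assoc]
  simp only [ENNReal.mul_rpow_of_nonneg _ _ (hc i).le]

theorem Splitting.intProd_mul_le_of_semicontinuous (σ : Splitting B BT BQ)
    (hcrit : ∑ i, c i * (Module.finrank ℝ (ET i) : ℝ) =
      ∑ j, d j * (Module.finrank ℝ (FT j) : ℝ))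
    (hc : ∀ i, 0 < c i) (hd : ∀ j, 0 < d j)
    {D₀ : ℝ} (h : IsBound E F c d B D₀)
    {u : ∀ i, ET i → ℝ≥0} {g v : ∀ j, FT j → ℝ≥0} {f'' : ∀ i, EQ i → ℝ≥0}
    {g'' : ∀ j, FQ j → ℝ≥0} (hut : ∀ i, Tame (u i))
    (hu : ∀ i, UpperSemicontinuous (u i)) (hv : ∀ j, LowerSemicontinuous (v j))
    (hgv : ∀ j y, g j y < v j y) (hug : Hyp ET FT c d BT u g)
    (hf'' : ∀ i, Tame (f'' i)) (hg'' : ∀ j, Tame (g'' j)) (hfg'' : Hyp EQ FQ c d BQ f'' g'') :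
    intProd c u * intProd c f'' ≤
      ENNReal.ofReal (Real.exp D₀) * (intProd d v * intProd d g'') := by
  choose r hr using fun i => (hut i).2
  choose r' hr' using fun i => (hf'' i).2
  have hle : ∀ (s : Fin k → ℝ≥0) i, (s i : ℝ) ≤ ((∑ i, s i : ℝ≥0) : ℝ) := fun s i => by
    exact_mod_cast Finset.single_le_sum (f := s) (fun _ _ => zero_le) (Finset.mem_univ i)
  obtain ⟨δ, hδ, hpert⟩ := exists_perturbation hc hd (∑ i, r i : ℝ≥0).2 hu
    (fun i x hx => ((hr i x).2 hx).trans (hle r i)) hv hgv hug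
  set ρ : ℝ≥0 := ∑ i, r' i
  set L : ℝ := ∑ j, ‖sumMap c σ.R j‖
  have hL : 0 ≤ L := Finset.sum_nonneg fun j _ => norm_nonneg (sumMap c σ.R j)
  set t : ℝ := 1 + L * ρ / δ
  have ht : 0 < t := by positivity
  have hyp : Hyp E F c d B
      (fun i x => u i (t⁻¹ • ((σ.eE i).symm x).1) * f'' i ((σ.eE i).symm x).2)
      (fun j y => v j (t⁻¹ • ((σ.eF j).symm y).1) * g'' j ((σ.eF j).symm y).2) := by
    refine hyp_iff.2 fun z => ?_
    obtain ⟨x, x', rfl⟩ : ∃ x x', z = fun i => σ.eE i (x i, x' i) :=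
      ⟨fun i => ((σ.eE i).symm (z i)).1, fun i => ((σ.eE i).symm (z i)).2, by simp⟩
    simp only [σ.sumMap_eE, ContinuousLinearEquiv.symm_apply_apply, NNReal.mul_rpow,
      Finset.prod_mul_distrib]
    by_cases hx : ∃ i, f'' i (x' i) = 0
    · rw [(prod_nnrpow_eq_zero_iff hc).2 hx, mul_zero]
      exact zero_le
    push Not at hx
    have hxρ : ‖x'‖ ≤ ρ := (pi_norm_le_iff_of_nonneg ρ.2).2 fun i =>
      ((hr' i (x' i)).2 (hx i)).trans (hle r' i)
    refine mul_le_mul' ?_ (hyp_iff.1 hfg'' x')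
    have hw := hpert (fun j => t⁻¹ • sumMap c σ.R j x') (fun j => ?_) fun i => t⁻¹ • x i
    · have hsm : ∀ j, sumMap c BT j (fun i => t⁻¹ • x i) = t⁻¹ • sumMap c BT j x := fun j =>
        map_smul (sumMap c BT j) t⁻¹ x
      simpa only [hsm, ← smul_add] using hw
    · have h1 : ‖sumMap c σ.R j x'‖ ≤ L * ρ :=
        (sumMap c σ.R j).le_of_opNorm_le_of_le
          (Finset.single_le_sum (f := fun j => ‖sumMap c σ.R j‖) (fun j _ => norm_nonneg (sumMap c σ.R j))
            (Finset.mem_univ j)) hxρ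
      rw [norm_smul, norm_inv, Real.norm_of_nonneg ht.le, inv_mul_lt_iff₀ ht]
      have h2 : t * δ = δ + L * ρ := by
        simp only [t]
        field_simp
      linarith
  have hum := fun i => (hut i).1
  have hvm := fun j => (hv j).measurable
  have h1 := intProd_tensor σ.eE σ.mpE hc hum (fun i => (hf'' i).1) ht
  have h2 := intProd_tensor σ.eF σ.mpF hd hvm (fun j => (hg'' j).1) ht
  have hbound := h1.symm.trans_le ((h _ _
    (fun i => ((hum i).comp (g := u i) (f := fun x => t⁻¹ • ((σ.eE i).symm x).1) (by fun_prop)).mul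
      ((hf'' i).1.comp (by fun_prop)))
    (fun j => ((hvm j).comp (g := v j) (f := fun y => t⁻¹ • ((σ.eF j).symm y).1) (by fun_prop)).mul
      ((hg'' j).1.comp (by fun_prop))) hyp).trans_eq (congrArg _ h2))
  rw [hcrit, mul_left_comm (ENNReal.ofReal (Real.exp D₀))] at hbound
  exact (ENNReal.mul_le_mul_iff_right (by simpa using Real.rpow_pos_of_pos ht _)
    ENNReal.ofReal_ne_top).1 hbound

/-- A bound for the whole datum tests on products of functions admissible for the blocks. -/
theorem Splitting.intProd_mul_le (σ : Splitting B BT BQ)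
    (hcrit : ∑ i, c i * (Module.finrank ℝ (ET i) : ℝ) =
      ∑ j, d j * (Module.finrank ℝ (FT j) : ℝ))
    (hc : ∀ i, 0 < c i) (hd : ∀ j, 0 < d j)
    {D₀ : ℝ} (h : IsBound E F c d B D₀)
    {f' : ∀ i, ET i → ℝ≥0} {g' : ∀ j, FT j → ℝ≥0} {f'' : ∀ i, EQ i → ℝ≥0}
    {g'' : ∀ j, FQ j → ℝ≥0} (hf' : ∀ i, Tame (f' i)) (hg' : ∀ j, Tame (g' j))
    (hfg' : Hyp ET FT c d BT f' g')
    (hf'' : ∀ i, Tame (f'' i)) (hg'' : ∀ j, Tame (g'' j)) (hfg'' : Hyp EQ FQ c d BQ f'' g'') :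
    intProd c f' * intProd c f'' ≤
      ENNReal.ofReal (Real.exp D₀) * (intProd d g' * intProd d g'') := by
  have key : ∀ ε : ℝ≥0, 0 < ε →
      (∏ i, ((∫⁻ x, (f' i x : ℝ≥0∞)) - ε) ^ c i) * intProd c f'' ≤ ENNReal.ofReal (Real.exp D₀) *
        ((∏ j, ((∫⁻ y, (g' j y : ℝ≥0∞)) + ε) ^ d j) * intProd d g'') := by
    intro ε hε
    have hε' : (ε : ℝ≥0∞) ≠ 0 := by simpa using hε.ne'
    choose u huf hu hui using fun i => exists_upperSemicontinuous_le_lintegral_le (f' i)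
      (hf' i).lintegral_ne_top hε'
    choose v hgv hv hvi using fun j => (hg' j).exists_lowerSemicontinuous hε'
    refine le_trans (mul_le_mul_left (prod_rpow_mono hc fun i => ?_) _)
      ((σ.intProd_mul_le_of_semicontinuous hcrit hc hd h
        (fun i => (hf' i).of_le (hu i).measurable (huf i)) hu hv hgv
        (fun x => (prod_nnrpow_mono hc fun i => huf i _).trans (hfg' x)) hf'' hg'' hfg'').trans
      (mul_le_mul_right (mul_le_mul_left (prod_rpow_mono hd fun j => hvi j) _) _))
    exact tsub_le_iff_right.2 (hui i)
  have h0 : Tendsto (fun ε : ℝ≥0 => (ε : ℝ≥0∞)) (𝓝[>] 0) (𝓝 0) := by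
    refine tendsto_nhdsWithin_of_tendsto_nhds ?_
    simpa using ENNReal.continuous_coe.tendsto (0 : ℝ≥0)
  refine le_of_tendsto_of_tendsto (b := 𝓝[>] (0 : ℝ≥0)) (f := fun ε : ℝ≥0 =>
      (∏ i, ((∫⁻ x, (f' i x : ℝ≥0∞)) - ε) ^ c i) * intProd c f'') (g := fun ε : ℝ≥0 =>
      ENNReal.ofReal (Real.exp D₀) *
        ((∏ j, ((∫⁻ y, (g' j y : ℝ≥0∞)) + ε) ^ d j) * intProd d g'')) ?_ ?_
    (eventually_nhdsWithin_of_forall key)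
  · refine ENNReal.Tendsto.mul_const
      (tendsto_prod_rpow hc (fun i => (hf' i).lintegral_ne_top) fun i => ?_)
      (Or.inr (intProd_ne_top hc hf''))
    simpa using ENNReal.Tendsto.sub tendsto_const_nhds h0 (Or.inl (hf' i).lintegral_ne_top)
  · refine ENNReal.Tendsto.const_mul (ENNReal.Tendsto.mul_const
      (tendsto_prod_rpow hd (fun j => (hg' j).lintegral_ne_top) fun j => ?_)
      (Or.inr (intProd_ne_top hd hg''))) (Or.inr ENNReal.ofReal_ne_top)
    simpa using h0.const_add (∫⁻ y, (g' j y : ℝ≥0∞))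

theorem exists_eq_ofReal_exp {a : ℝ≥0∞} (h0 : a ≠ 0) (ht : a ≠ ∞) :
    ∃ α : ℝ, a = ENNReal.ofReal (Real.exp α) :=
  ⟨Real.log a.toReal, by rw [Real.exp_log (ENNReal.toReal_pos h0 ht), ENNReal.ofReal_toReal ht]⟩

theorem ofReal_exp_le_mul_iff {α β s : ℝ} :
    ENNReal.ofReal (Real.exp α) ≤ ENNReal.ofReal (Real.exp s) * ENNReal.ofReal (Real.exp β) ↔
      α ≤ s + β := by
  rw [← ENNReal.ofReal_mul (Real.exp_pos _).le, ← Real.exp_add,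
    ENNReal.ofReal_le_ofReal_iff (Real.exp_pos _).le, Real.exp_le_exp]

theorem isBound_of_tame (hc : ∀ i, 0 < c i) (hd : ∀ j, 0 < d j) {s : ℝ}
    (h : TameBound c d B (ENNReal.ofReal (Real.exp s))) : IsBound E F c d B s :=
  fun _ _ hf hg hfg => TameBound.intProd_le hc hd ENNReal.ofReal_ne_top
    (by simpa using Real.exp_pos _) h hf hg hfg

variable (E F c d B) in
theorem bddBelow_isBound (hc : ∀ i, 0 < c i) (hd : ∀ j, 0 < d j) :
    BddBelow {s | IsBound E F c d B s} := by
  obtain ⟨f, g, hf, hg, hfg, h0⟩ := exists_tame_hyp E F c d B hc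
  obtain ⟨α, hα⟩ := exists_eq_ofReal_exp h0 (intProd_ne_top hc hf)
  rcases eq_or_ne (intProd d g) 0 with hg0 | hg0
  · refine ⟨0, fun s hs => (h0 ?_).elim⟩
    have h := hs f g (fun i => (hf i).1) (fun j => (hg j).1) hfg
    change intProd c f ≤ _ * intProd d g at h
    simpa [hg0] using h
  · obtain ⟨β, hβ⟩ := exists_eq_ofReal_exp hg0 (intProd_ne_top hd hg)
    refine ⟨α - β, fun s hs => ?_⟩
    have h := hs f g (fun i => (hf i).1) (fun j => (hg j).1) hfg
    change intProd c f ≤ _ * intProd d g at h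
    rw [hα, hβ, ofReal_exp_le_mul_iff] at h
    linarith

theorem D_eq_top (h : ¬ ∃ s, IsBound E F c d B s) : D E F c d B = ⊤ := by
  refine sInf_eq_top.2 ?_
  rintro _ ⟨s, -, hs⟩
  exact (h ⟨s, hs⟩).elim

theorem exists_D_eq_coe (hc : ∀ i, 0 < c i) (hd : ∀ j, 0 < d j) (h : ∃ s, IsBound E F c d B s) :
    ∃ t : ℝ, D E F c d B = t ∧ IsGLB {s | IsBound E F c d B s} t := by
  have hglb := isGLB_csInf (s := {s | IsBound E F c d B s}) h (bddBelow_isBound E F c d B hc hd)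
  refine ⟨_, IsGLB.sInf_eq ⟨?_, fun y hy => ?_⟩, hglb⟩
  · rintro _ ⟨s, rfl, hs⟩
    exact EReal.coe_le_coe_iff.2 (hglb.1 hs)
  · induction y with
    | bot => exact bot_le
    | coe y => exact EReal.coe_le_coe_iff.2 (hglb.2 fun s hs =>
        EReal.coe_le_coe_iff.1 (hy ⟨s, rfl, hs⟩))
    | top =>
      obtain ⟨s, hs⟩ := h
      exact absurd (hy ⟨s, rfl, hs⟩) (by simp)

theorem D_ne_bot (hc : ∀ i, 0 < c i) (hd : ∀ j, 0 < d j) : D E F c d B ≠ ⊥ := by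
  by_cases h : ∃ s, IsBound E F c d B s
  · obtain ⟨t, ht, -⟩ := exists_D_eq_coe hc hd h
    simp [ht]
  · simp [D_eq_top h]

theorem Splitting.intProd_ne_zero (σ : Splitting B BT BQ)
    (hcrit : ∑ i, c i * (Module.finrank ℝ (ET i) : ℝ) = ∑ j, d j * (Module.finrank ℝ (FT j) : ℝ))
    (hc : ∀ i, 0 < c i) (hd : ∀ j, 0 < d j) {D₀ : ℝ} (h : IsBound E F c d B D₀)
    {f'' : ∀ i, EQ i → ℝ≥0} {g'' : ∀ j, FQ j → ℝ≥0} (hf'' : ∀ i, Tame (f'' i))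
    (hg'' : ∀ j, Tame (g'' j)) (hfg'' : Hyp EQ FQ c d BQ f'' g'') (h0 : intProd c f'' ≠ 0) :
    intProd d g'' ≠ 0 := by
  obtain ⟨f', g', hf', hg', hfg', h0'⟩ := exists_tame_hyp ET FT c d BT hc
  intro hb
  have key := σ.intProd_mul_le hcrit hc hd h hf' hg' hfg' hf'' hg'' hfg''
  simp [hb, h0, h0'] at key

theorem Splitting.isBound_left (σ : Splitting B BT BQ)
    (hcrit : ∑ i, c i * (Module.finrank ℝ (ET i) : ℝ) = ∑ j, d j * (Module.finrank ℝ (FT j) : ℝ))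
    (hc : ∀ i, 0 < c i) (hd : ∀ j, 0 < d j) {D₀ : ℝ} (h : IsBound E F c d B D₀)
    {f'' : ∀ i, EQ i → ℝ≥0} {g'' : ∀ j, FQ j → ℝ≥0} (hf'' : ∀ i, Tame (f'' i))
    (hg'' : ∀ j, Tame (g'' j)) (hfg'' : Hyp EQ FQ c d BQ f'' g'') {α β : ℝ}
    (hα : intProd c f'' = ENNReal.ofReal (Real.exp α))
    (hβ : intProd d g'' = ENNReal.ofReal (Real.exp β)) :
    IsBound ET FT c d BT (D₀ + β - α) := by
  refine isBound_of_tame hc hd fun f' g' hf' hg' hfg' => ?_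
  have key := σ.intProd_mul_le hcrit hc hd h hf' hg' hfg' hf'' hg'' hfg''
  rw [hα, hβ] at key
  refine (ENNReal.mul_le_mul_iff_left (c := ENNReal.ofReal (Real.exp α))
    (by simpa using Real.exp_pos _) ENNReal.ofReal_ne_top).1 (key.trans_eq ?_)
  rw [mul_right_comm, ← ENNReal.ofReal_mul (Real.exp_pos _).le, ← Real.exp_add, sub_add_cancel,
    Real.exp_add, ENNReal.ofReal_mul (Real.exp_pos _).le, mul_assoc, mul_comm (intProd d g')]

theorem Splitting.exists_isBound_left (σ : Splitting B BT BQ)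
    (hcrit : ∑ i, c i * (Module.finrank ℝ (ET i) : ℝ) = ∑ j, d j * (Module.finrank ℝ (FT j) : ℝ))
    (hc : ∀ i, 0 < c i) (hd : ∀ j, 0 < d j) {D₀ : ℝ} (h : IsBound E F c d B D₀) :
    ∃ s, IsBound ET FT c d BT s := by
  obtain ⟨f'', g'', hf'', hg'', hfg'', h0⟩ := exists_tame_hyp EQ FQ c d BQ hc
  obtain ⟨α, hα⟩ := exists_eq_ofReal_exp h0 (intProd_ne_top hc hf'')
  obtain ⟨β, hβ⟩ := exists_eq_ofReal_exp
    (σ.intProd_ne_zero hcrit hc hd h hf'' hg'' hfg'' h0) (intProd_ne_top hd hg'')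
  exact ⟨_, σ.isBound_left hcrit hc hd h hf'' hg'' hfg'' hα hβ⟩

theorem Splitting.isBound_sub (σ : Splitting B BT BQ)
    (hcrit : ∑ i, c i * (Module.finrank ℝ (ET i) : ℝ) = ∑ j, d j * (Module.finrank ℝ (FT j) : ℝ))
    (hc : ∀ i, 0 < c i) (hd : ∀ j, 0 < d j) {D₀ : ℝ} (h : IsBound E F c d B D₀) {t : ℝ}
    (ht : t ∈ lowerBounds {s | IsBound ET FT c d BT s}) : IsBound EQ FQ c d BQ (D₀ - t) := by
  refine isBound_of_tame hc hd fun f'' g'' hf'' hg'' hfg'' => ?_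
  rcases eq_or_ne (intProd c f'') 0 with h0 | h0
  · rw [h0]
    exact zero_le
  obtain ⟨α, hα⟩ := exists_eq_ofReal_exp h0 (intProd_ne_top hc hf'')
  obtain ⟨β, hβ⟩ := exists_eq_ofReal_exp
    (σ.intProd_ne_zero hcrit hc hd h hf'' hg'' hfg'' h0) (intProd_ne_top hd hg'')
  have h1 := ht (σ.isBound_left hcrit hc hd h hf'' hg'' hfg'' hα hβ)
  rw [hα, hβ, ofReal_exp_le_mul_iff]
  linarith

theorem Splitting.D_eq_add [Nonempty (Fin k)] (σ : Splitting B BT BQ)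
    (hcrit : ∑ i, c i * (Module.finrank ℝ (ET i) : ℝ) = ∑ j, d j * (Module.finrank ℝ (FT j) : ℝ))
    (hc : ∀ i, 0 < c i) (hd : ∀ j, 0 < d j) :
    D E F c d B = D ET FT c d BT + D EQ FQ c d BQ := by
  by_cases h : ∃ s, IsBound E F c d B s
  · obtain ⟨z, hz, hzglb⟩ := exists_D_eq_coe hc hd h
    obtain ⟨D₀, hD₀⟩ := h
    obtain ⟨t, ht, htglb⟩ := exists_D_eq_coe hc hd (σ.exists_isBound_left hcrit hc hd hD₀)
    obtain ⟨q, hq, hqglb⟩ := exists_D_eq_coe hc hd ⟨_, σ.isBound_sub hcrit hc hd hD₀ htglb.1⟩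
    rw [hz, ht, hq, ← EReal.coe_add, EReal.coe_eq_coe_iff]
    apply le_antisymm
    · have h1 : z - q ≤ t := htglb.2 fun a ha => by
        have h2 : z - a ≤ q := hqglb.2 fun b hb => by
          have h3 := hzglb.1 (σ.isBound_add hc hd ha hb)
          linarith
        linarith
      linarith
    · refine hzglb.2 fun s hs => ?_
      have h1 := hqglb.1 (σ.isBound_sub hcrit hc hd hs htglb.1)
      linarith
  · rw [D_eq_top h]
    by_cases h' : ∃ s, IsBound ET FT c d BT s
    · rw [D_eq_top (B := BQ) fun h'' => h ?_, EReal.add_top_of_ne_bot (D_ne_bot hc hd)]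
      obtain ⟨a, ha⟩ := h'
      obtain ⟨b, hb⟩ := h''
      exact ⟨_, σ.isBound_add hc hd ha hb⟩
    · rw [D_eq_top h', EReal.top_add_of_ne_bot (D_ne_bot hc hd)]

end Splitting
section Orthogonal

variable {G GT GQ : Type*}
  [NormedAddCommGroup G] [InnerProductSpace ℝ G] [FiniteDimensional ℝ G]
  [MeasurableSpace G] [BorelSpace G]
  [NormedAddCommGroup GT] [InnerProductSpace ℝ GT] [FiniteDimensional ℝ GT]
  [MeasurableSpace GT] [BorelSpace GT]
  [NormedAddCommGroup GQ] [InnerProductSpace ℝ GQ] [FiniteDimensional ℝ GQ]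
  [MeasurableSpace GQ] [BorelSpace GQ]

/-- The splitting of a space given by an orthogonal direct sum decomposition. -/
def prodEquivOfIsometry (e : WithLp 2 (GT × GQ) ≃ₗᵢ[ℝ] G) : (GT × GQ) ≃L[ℝ] G :=
  (WithLp.prodContinuousLinearEquiv 2 ℝ GT GQ).symm.trans e.toContinuousLinearEquiv

theorem measurePreserving_prodEquivOfIsometry (e : WithLp 2 (GT × GQ) ≃ₗᵢ[ℝ] G) :
    MeasurePreserving (prodEquivOfIsometry e) (volume.prod volume) volume :=
  e.measurePreserving.comp (WithLp.volume_preserving_toLp GT GQ)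

theorem prodEquivOfIsometry_orthogonalDecomposition_apply (K : Submodule ℝ G) (x : K) (y : Kᗮ) :
    prodEquivOfIsometry K.orthogonalDecomposition.symm (x, y) = (x : G) + y := by
  simp [prodEquivOfIsometry]

end Orthogonal

section OrthogonalSplitting

variable {k m : ℕ}
  {E : Fin k → Type*} {F : Fin m → Type*}
  [∀ i, NormedAddCommGroup (E i)] [∀ i, InnerProductSpace ℝ (E i)]
  [∀ i, FiniteDimensional ℝ (E i)]
  [∀ i, MeasurableSpace (E i)] [∀ i, BorelSpace (E i)]
  [∀ j, NormedAddCommGroup (F j)] [∀ j, InnerProductSpace ℝ (F j)]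
  [∀ j, FiniteDimensional ℝ (F j)]
  [∀ j, MeasurableSpace (F j)] [∀ j, BorelSpace (F j)]

/-- The orthogonal splitting of a datum along subspaces `S i`, `W j` with `B i j (S i) ⊆ W j`. -/
def Splitting.ofOrthogonal (B : ∀ i j, E i →ₗ[ℝ] F j)
    (S : ∀ i, Submodule ℝ (E i)) (W : ∀ j, Submodule ℝ (F j))
    (BT : ∀ i j, ↥(S i) →ₗ[ℝ] ↥(W j)) (hBT : ∀ i j (x : ↥(S i)), (BT i j x : F j) = B i j (x : E i))
    (BQ : ∀ i j, ↥((S i)ᗮ) →ₗ[ℝ] ↥((W j)ᗮ))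
    (hBQ : ∀ i j (x : ↥((S i)ᗮ)), B i j (x : E i) - (BQ i j x : F j) ∈ W j) :
    Splitting B BT BQ where
  eE i := prodEquivOfIsometry (S i).orthogonalDecomposition.symm
  eF j := prodEquivOfIsometry (W j).orthogonalDecomposition.symm
  mpE i := measurePreserving_prodEquivOfIsometry _
  mpF j := measurePreserving_prodEquivOfIsometry _
  R i j := ((B i j).comp (S i)ᗮ.subtype - (W j)ᗮ.subtype.comp (BQ i j)).codRestrict (W j) (hBQ i j)
  map_eE i j x x' := by
    simp only [prodEquivOfIsometry_orthogonalDecomposition_apply, map_add, Submodule.coe_add, hBT]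
    change _ = B i j x + (B i j x' - (BQ i j x' : F j)) + (BQ i j x' : F j)
    abel

end OrthogonalSplitting

end FRBL

namespace FRBL

variable {k m : ℕ}
  (E : Fin k → Type*) (F : Fin m → Type*)
  [∀ i, NormedAddCommGroup (E i)] [∀ i, InnerProductSpace ℝ (E i)]
  [∀ i, FiniteDimensional ℝ (E i)]
  [∀ i, MeasurableSpace (E i)] [∀ i, BorelSpace (E i)]
  [∀ j, NormedAddCommGroup (F j)] [∀ j, InnerProductSpace ℝ (F j)]
  [∀ j, FiniteDimensional ℝ (F j)]
  [∀ j, MeasurableSpace (F j)] [∀ j, BorelSpace (F j)]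

/-- **Corollary (decomposability at critical subspaces, functional constant).** If `T` is
a critical subspace for `(c,d,B)`, then `D(c,d,B) = D(c,d,B_T) + D(c,d,B_{E₀/T})`. -/
theorem D_decompose_critical
    (c : Fin k → ℝ) (d : Fin m → ℝ) (B : ∀ i j, E i →ₗ[ℝ] F j)
    (hc : ∀ i, 0 < c i) (hd : ∀ j, 0 < d j)
    (T : Submodule ℝ (PiLp 2 E)) (hT : IsCritical E F c d B T)
    (BT : ∀ i j, ↥(T.map (projL E i)) →ₗ[ℝ] ↥(T.map (Bop E F B j)))
    (hBT : ∀ i j (x : ↥(T.map (projL E i))), (BT i j x : F j) = B i j (x : E i))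
    (BQ : ∀ i j, ↥((T.map (projL E i))ᗮ) →ₗ[ℝ] ↥((T.map (Bop E F B j))ᗮ))
    (hBQ : ∀ i j (x : ↥((T.map (projL E i))ᗮ)),
      B i j (x : E i) - (BQ i j x : F j) ∈ T.map (Bop E F B j)) :
    D E F c d B =
      D (fun i => ↥(T.map (projL E i))) (fun j => ↥(T.map (Bop E F B j))) c d BT +
      D (fun i => ↥((T.map (projL E i))ᗮ)) (fun j => ↥((T.map (Bop E F B j))ᗮ)) c d BQ := by
  have hk : Nonempty (Fin k) := by
    refine not_isEmpty_iff.1 fun h => hT.1 ((Submodule.eq_bot_iff T).2 fun x _ => ?_)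
    ext i
    exact h.elim i
  exact (Splitting.ofOrthogonal B _ _ BT hBT BQ hBQ).D_eq_add hT.2.2.2 hc hd

end FRBL
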